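/- Let D be a division ring and D[t] the polynomial ring over D in one central variable. Assume D[t] satisfies the Ore condition and let D(t) = Ore(D[t]) be its Ore field of fractions, with canonical embedding ι : D[t] → D(t). Let σ : D → M_n(D) be a unital ring homomorphism, extended coefficientwise to σ̂ : D[t] → M_n(D[t]) (for p = Σ_j d_j t^j, σ̂(p) is the matrix whose (i,i') entry is Σ_j (σ(d_j))_{ii'} t^j). Then there exists a ring homomorphism Φ : D(t) → M_n(D(t)) such that for every p ∈ D[t], Φ(ι(p)) equals the matrix obtained by applying ι to every entry of σ̂(p). -/

import Mathlib

open scoped Polynomial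

/-- The coefficientwise extension of a ring homomorphism `σ : D → M_n(D)` to polynomials:
for `p = Σ_j d_j t^j`, the `(i, i')` entry of `polyExt σ p` is the polynomial
`Σ_j (σ (d_j))_{i i'} t^j`. -/
noncomputable def polyExt {D : Type*} [DivisionRing D] {n : ℕ}
    (σ : D →+* Matrix (Fin n) (Fin n) D) (p : D[X]) :
    Matrix (Fin n) (Fin n) D[X] :=
  Matrix.of fun i i' => ∑ j ∈ p.support, Polynomial.monomial j (σ (p.coeff j) i i')


section Helpers

variable {D : Type*} [DivisionRing D] {n : ℕ} (σ : D →+* Matrix (Fin n) (Fin n) D)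

theorem polyExt_coeff (p : D[X]) (i j : Fin n) (k : ℕ) :
    (polyExt σ p i j).coeff k = σ (p.coeff k) i j := by
  simp only [polyExt, Matrix.of_apply, Polynomial.finsetSum_coeff, Polynomial.coeff_monomial]
  rw [Finset.sum_ite_eq']
  split_ifs with h
  · rfl
  · rw [Polynomial.notMem_support_iff.mp h]; simp

noncomputable def polyExtHom : D[X] →+* Matrix (Fin n) (Fin n) D[X] where
  toFun := polyExt σ
  map_one' := by
    ext i j k
    rw [polyExt_coeff, Polynomial.coeff_one]
    by_cases hij : i = j <;> by_cases hk : k = 0 <;>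
      simp [Matrix.one_apply, Polynomial.coeff_one, hij, hk]
  map_zero' := by
    ext i j k
    rw [polyExt_coeff]; simp
  map_add' p q := by
    ext i j k
    simp [polyExt_coeff]
  map_mul' p q := by
    ext i j k
    simp only [polyExt_coeff, Matrix.mul_apply, Polynomial.finsetSum_coeff, Polynomial.coeff_mul,
      map_sum, map_mul, Matrix.sum_apply]
    rw [Finset.sum_comm]

theorem polyExt_regular (p : D[X]) (hp : p ≠ 0) (B : Matrix (Fin n) (Fin n) D[X])
    (h : B * polyExt σ p = 0) : B = 0 := by
  have key : ∀ M : ℕ, (∀ i j k, M ≤ k → (B i j).coeff k = 0) → B = 0 := by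
    intro M
    induction M with
    | zero =>
      intro hM
      ext i j k
      simpa using hM i j k (Nat.zero_le _)
    | succ M ih =>
      intro hM
      apply ih
      have h1 : (Matrix.of fun i j => (B i j).coeff M) * σ p.leadingCoeff = 0 := by
        ext i j
        have h2 : ((B * polyExt σ p) i j).coeff (M + p.natDegree) = 0 := by rw [h]; simp
        rw [Matrix.mul_apply, Polynomial.finsetSum_coeff] at h2
        rw [Matrix.mul_apply, Matrix.zero_apply, ← h2]
        refine Finset.sum_congr rfl fun l _ => ?_
        rw [Polynomial.coeff_mul, Finset.sum_eq_single (M, p.natDegree)]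
        · simp [polyExt_coeff]
        · rintro ⟨a, b⟩ hab hne
          have hab : a + b = M + p.natDegree := by simpa using hab
          rcases Nat.lt_or_ge M a with ha | ha
          · simp [hM i l a ha]
          · have hb : p.natDegree < b := by
              rcases Nat.lt_or_ge p.natDegree b with hb | hb
              · exact hb
              · exact absurd (by ext <;> simp <;> omega) hne
            simp [polyExt_coeff, Polynomial.coeff_eq_zero_of_natDegree_lt hb]
        · simp
      have hl : p.leadingCoeff ≠ 0 := by simpa using hp
      have h3 : (Matrix.of fun i j => (B i j).coeff M) = 0 := by
        calc _ = (Matrix.of fun i j => (B i j).coeff M) * σ p.leadingCoeff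
              * σ p.leadingCoeff⁻¹ := by
              rw [mul_assoc, ← map_mul, mul_inv_cancel₀ hl, map_one, mul_one]
          _ = 0 := by rw [h1, zero_mul]
      intro i j k hk
      rcases Nat.eq_or_lt_of_le hk with rfl | hk
      · exact congrFun (congrFun h3 i) j
      · exact hM i j k hk
  apply key (Finset.univ.sup fun i => Finset.univ.sup fun j => (B i j).natDegree + 1)
  intro i j k hk
  apply Polynomial.coeff_eq_zero_of_natDegree_lt
  have h1 : (B i j).natDegree + 1 ≤ Finset.univ.sup fun j => (B i j).natDegree + 1 :=
    Finset.le_sup (f := fun j => (B i j).natDegree + 1) (Finset.mem_univ j)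
  have h2 := Finset.le_sup (f := fun i => Finset.univ.sup fun j => (B i j).natDegree + 1)
    (Finset.mem_univ i)
  exact lt_of_lt_of_le (Nat.lt_succ_self _) (h1.trans (h2.trans hk))

theorem ore_common_denom {R : Type*} [Ring R] (S : Submonoid R) [OreLocalization.OreSet S]
    {ι : Type*} (x : ι → OreLocalization S R) (t : Finset ι) :
    ∃ s : S, ∀ i ∈ t, ∃ r : R, (OreLocalization.numeratorRingHom (s : R) :
      OreLocalization S R) * x i = OreLocalization.numeratorRingHom r := by
  classical
  induction t using Finset.induction_on with
  | empty => exact ⟨1, by simp⟩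
  | insert a t ha ih =>
    obtain ⟨s, hs⟩ := ih
    obtain ⟨r', s', hx⟩ : ∃ (r' : R) (s' : S), x a = r' /ₒ s' := by
      induction x a using OreLocalization.ind with
      | _ r s => exact ⟨r, s, rfl⟩
    have hx' : (OreLocalization.numeratorRingHom (s' : R) : OreLocalization S R) * x a
        = OreLocalization.numeratorRingHom r' := by
      rw [hx]
      exact OreLocalization.mul_cancel (S := S)
    obtain ⟨u, v, huv⟩ := OreLocalization.oreCondition (s : R) s'
    refine ⟨v * s, fun i hi => ?_⟩
    rcases Finset.mem_insert.mp hi with rfl | hi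
    · refine ⟨u * r', ?_⟩
      rw [Submonoid.coe_mul, huv, map_mul, map_mul, mul_assoc, hx']
    · obtain ⟨r, hr⟩ := hs i hi
      refine ⟨v * r, ?_⟩
      rw [Submonoid.coe_mul, map_mul, map_mul, mul_assoc, hr]

theorem polyExt_isUnit [OreLocalization.OreSet (nonZeroDivisors D[X])] (p : D[X]) (hp : p ≠ 0) :
    IsUnit ((OreLocalization.numeratorRingHom :
      D[X] →+* OreLocalization (nonZeroDivisors D[X]) D[X]).mapMatrix (polyExt σ p)) := by
  set K := OreLocalization (nonZeroDivisors D[X]) D[X] with hK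
  set φ : D[X] →+* K := OreLocalization.numeratorRingHom with hφ
  have hinj : Function.Injective φ :=
    OreLocalization.numeratorHom_inj (fun x hx => hx.1)
  let L : Matrix (Fin n) (Fin n) K →ₗ[K] Matrix (Fin n) (Fin n) K :=
    { toFun := fun B => B * φ.mapMatrix (polyExt σ p)
      map_add' := fun a b => add_mul _ _ _
      map_smul' := fun a b => Matrix.smul_mul _ _ _ }
  have hL : Function.Injective L := by
    rw [injective_iff_map_eq_zero]
    intro B hB
    replace hB : B * φ.mapMatrix (polyExt σ p) = 0 := hB
    obtain ⟨s, hs⟩ := ore_common_denom (nonZeroDivisors D[X])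
      (fun ij : Fin n × Fin n => B ij.1 ij.2) Finset.univ
    have hs' : ∀ i j, ∃ r : D[X], φ (s : D[X]) * B i j = φ r :=
      fun i j => hs (i, j) (Finset.mem_univ _)
    choose B' hB' using hs'
    have e : φ (s : D[X]) • B = φ.mapMatrix (Matrix.of B') := by
      ext i j
      exact hB' i j
    have h0 : φ.mapMatrix (Matrix.of B' * polyExt σ p) = 0 := by
      rw [map_mul, ← e, Matrix.smul_mul, hB, smul_zero]
    have h1 : Matrix.of B' * polyExt σ p = 0 := by
      ext1 i j
      apply hinj
      rw [Matrix.zero_apply, map_zero]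
      exact congrFun (congrFun h0 i) j
    have h2 := polyExt_regular σ p hp _ h1
    have hs0 : φ (s : D[X]) ≠ 0 := by
      intro h
      exact nonZeroDivisors.coe_ne_zero s (hinj (by rw [h, map_zero]))
    rw [h2, map_zero] at e
    ext i j
    have e' : φ (s : D[X]) * B i j = 0 := congrFun (congrFun e i) j
    exact (mul_eq_zero.mp e').resolve_left hs0
  obtain ⟨C, hC⟩ := (LinearMap.injective_iff_surjective.mp hL) 1
  replace hC : C * φ.mapMatrix (polyExt σ p) = 1 := hC
  exact ⟨⟨_, C, mul_eq_one_comm.mp hC, hC⟩, rfl⟩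

end Helpers

/-- Let `D` be a division ring whose polynomial ring `D[t]` satisfies the Ore
condition, with Ore field of fractions `D(t) = Ore(D[t])` and canonical embedding `ι`.  Let
`σ : D → M_n(D)` be a unital ring homomorphism, extended coefficientwise to
`σ̂ : D[t] → M_n(D[t])`.  Then there is a ring homomorphism `Φ : D(t) → M_n(D(t))` with
`Φ (ι p) = ι(σ̂ p)` (entrywise `ι`) for all `p ∈ D[t]`. -/
theorem polyExt_extends_to_oreLocalization
    (D : Type*) [DivisionRing D] (n : ℕ) (hn : 0 < n)
    [OreLocalization.OreSet (nonZeroDivisors D[X])]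
    (σ : D →+* Matrix (Fin n) (Fin n) D) :
    ∃ Φ : OreLocalization (nonZeroDivisors D[X]) D[X] →+*
        Matrix (Fin n) (Fin n) (OreLocalization (nonZeroDivisors D[X]) D[X]),
      ∀ p : D[X],
        Φ (OreLocalization.numeratorRingHom p) =
          (polyExt σ p).map
            (OreLocalization.numeratorRingHom :
              D[X] →+* OreLocalization (nonZeroDivisors D[X]) D[X]) := by
  classical
  let f : D[X] →+* Matrix (Fin n) (Fin n) (OreLocalization (nonZeroDivisors D[X]) D[X]) :=
    (OreLocalization.numeratorRingHom.mapMatrix).comp (polyExtHom σ)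
  have hu : ∀ s : nonZeroDivisors D[X], IsUnit (f s) := fun s =>
    polyExt_isUnit σ s (nonZeroDivisors.coe_ne_zero s)
  let fS : nonZeroDivisors D[X] →*
      (Matrix (Fin n) (Fin n) (OreLocalization (nonZeroDivisors D[X]) D[X]))ˣ :=
    IsUnit.liftRight (f.toMonoidHom.comp (nonZeroDivisors D[X]).subtype) hu
  refine ⟨OreLocalization.universalHom f fS fun s => ?_, fun p => ?_⟩
  · exact (IsUnit.coe_liftRight (f.toMonoidHom.comp (nonZeroDivisors D[X]).subtype) hu s).symm
  · exact OreLocalization.universalHom_commutes f fS _
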